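/- arXiv:1909.01627 — 2 statements merged into one kernel-verified Lean document; each statement's English description precedes it below -/
import Mathlib

section
/- Let k ≥ 1 and let msc be an MSC satisfying causal delivery. Then msc is k-synchronous if and only if every strongly connected component of the conflict graph of msc has size at most k and no RS edge (an edge of the form v →_{RS} v') occurs on any cyclic path of the conflict graph. -/
set_option autoImplicit false

/-! ## Actions -/

/-- A send or receive action over processes `P` and messages `M`. -/
inductive Act (P M : Type) : Type
  | send (p q : P) (m : M)
  | recv (p q : P) (m : M)
  deriving DecidableEq

namespace Act
variable {P M : Type}

def isSend : Act P M → Prop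
  | send _ _ _ => True
  | recv _ _ _ => False

def isRecv : Act P M → Prop
  | send _ _ _ => False
  | recv _ _ _ => True

/-- The process performing the action: the sender of a send, the receiver of a receive. -/
def proc : Act P M → P
  | send p _ _ => p
  | recv _ q _ => q

end Act

/-- The two kinds of actions of a message exchange: `S`end and `R`eceive. -/
inductive SR : Type
  | S | R
  deriving DecidableEq

/-- Nodes of conflict graphs with summary nodes: ordinary message exchanges
(identified by the position of their send action), summary nodes `λ_p`, and the node `ψ`. -/
inductive GNode (P : Type) : Type
  | ex (v : ℕ)
  | sum (p : P)
  | psi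

/-! ## Matching, message exchanges -/

section Core
variable {P M : Type} [DecidableEq P] [DecidableEq M]

/-- The send at position `i` of `e` is matched by the receive at position `j`:
for some `ℓ`, they are the `ℓ`-th send resp. receive with the given sender/receiver/message. -/
def Matches (e : List (Act P M)) (i j : ℕ) : Prop :=
  i < j ∧ j < e.length ∧ ∃ p q m,
    e[i]? = some (Act.send p q m) ∧ e[j]? = some (Act.recv p q m) ∧
    (e.take (i + 1)).count (Act.send p q m) = (e.take (j + 1)).count (Act.recv p q m)

/-- Message exchanges (vertices of the conflict graph) are identified with the
positions of their send actions. -/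
def IsVertex (e : List (Act P M)) (v : ℕ) : Prop :=
  ∃ p q m, e[v]? = some (Act.send p q m)

def MatchedSend (e : List (Act P M)) (v : ℕ) : Prop := ∃ j, Matches e v j

def UnmatchedSend (e : List (Act P M)) (v : ℕ) : Prop := IsVertex e v ∧ ¬ MatchedSend e v

def SenderIs (e : List (Act P M)) (v : ℕ) (p : P) : Prop := ∃ q m, e[v]? = some (Act.send p q m)

def ReceiverIs (e : List (Act P M)) (v : ℕ) (q : P) : Prop := ∃ p m, e[v]? = some (Act.send p q m)

/-- A well-formed sequence of actions: every receive is matched. -/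
def WFSeq (e : List (Act P M)) : Prop :=
  ∀ j p q m, e[j]? = some (Act.recv p q m) → ∃ i, Matches e i j

end Core

/-! ## MSCs -/

/-- A message sequence chart, presented on `Fin n`. MSCs are identified up to isomorphism. -/
structure MSC (P M : Type) : Type where
  n : ℕ
  label : Fin n → Act P M
  po : Fin n → Fin n → Prop
  src : Fin n → Fin n → Prop

namespace MSC
variable {P M : Type}

/-- The causality order `≺ = (≺_po ∪ ≺_src)⁺`. -/
def prec (m : MSC P M) : Fin m.n → Fin m.n → Prop :=
  Relation.TransGen (fun i j => m.po i j ∨ m.src i j)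

/-- Well-formedness of an MSC: `po` is a strict partial order total on each process's
events, and `src` relates each receive to exactly one send with matching labels,
each send to at most one receive. -/
def WF (m : MSC P M) : Prop :=
  Transitive m.po ∧ (∀ i, ¬ m.po i i) ∧
  (∀ i j, i ≠ j → (m.label i).proc = (m.label j).proc → m.po i j ∨ m.po j i) ∧
  (∀ r, (m.label r).isRecv → ∃! s, m.src s r) ∧
  (∀ s, (m.label s).isSend → ∀ r r', m.src s r → m.src s r' → r = r') ∧
  (∀ s r, m.src s r → ∃ p q v, m.label s = Act.send p q v ∧ m.label r = Act.recv p q v)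

end MSC

section MSCs
variable {P M : Type} [DecidableEq P] [DecidableEq M]

/-- The MSC `msc(e)` of a (well-formed) sequence of actions `e`. -/
def mscOf (e : List (Act P M)) : MSC P M where
  n := e.length
  label i := e.get i
  po i j := (i : ℕ) < (j : ℕ) ∧ (e.get i).proc = (e.get j).proc
  src i j := Matches e i j

/-- `f` is an isomorphism of MSCs. -/
def IsMSCIso (m₁ m₂ : MSC P M) (f : Fin m₁.n ≃ Fin m₂.n) : Prop :=
  (∀ i, m₂.label (f i) = m₁.label i) ∧
  (∀ i j, m₁.po i j ↔ m₂.po (f i) (f j)) ∧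
  (∀ i j, m₁.src i j ↔ m₂.src (f i) (f j))

/-- Isomorphism of MSCs (MSCs are identified up to isomorphism). -/
def MSC.Iso (m₁ m₂ : MSC P M) : Prop := ∃ f, IsMSCIso m₁ m₂ f

/-- `e` is a linearisation of the MSC `m`: `e` is well-formed and `msc(e) = m`. -/
def Linearisation (e : List (Act P M)) (m : MSC P M) : Prop :=
  WFSeq e ∧ MSC.Iso (mscOf e) m

/-- Causal delivery (mailbox): some linearisation is such that any two causally ordered
sends to a same process are either received in the same order, or the later one is unmatched. -/
def CausalDelivery (m : MSC P M) : Prop :=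
  ∃ e : List (Act P M), Linearisation e m ∧
    ∀ (i j : Fin (mscOf e).n) (p p' q : P) (v v' : M),
      (mscOf e).prec i j →
      (mscOf e).label i = Act.send p q v →
      (mscOf e).label j = Act.send p' q v' →
      (¬ MatchedSend e j.val) ∨
        ∃ i' j' : Fin (mscOf e).n,
          Matches e i.val i'.val ∧ Matches e j.val j'.val ∧ (mscOf e).prec i' j'

/-- Peer-to-peer causal delivery: as causal delivery but only for two sends with the
same sender *and* the same receiver. -/
def P2PCausalDelivery (m : MSC P M) : Prop :=
  ∃ e : List (Act P M), Linearisation e m ∧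
    ∀ (i j : Fin (mscOf e).n) (p q : P) (v v' : M),
      (mscOf e).prec i j →
      (mscOf e).label i = Act.send p q v →
      (mscOf e).label j = Act.send p q v' →
      (¬ MatchedSend e j.val) ∨
        ∃ i' j' : Fin (mscOf e).n,
          Matches e i.val i'.val ∧ Matches e j.val j'.val ∧ (mscOf e).prec i' j'

end MSCs

/-! ## Conflict graphs -/

section CG
variable {P M : Type} [DecidableEq P] [DecidableEq M]

/-- The position of the `X`-action of the message exchange `v`. -/
def XAt (e : List (Act P M)) (v : ℕ) : SR → ℕ → Prop
  | SR.S, i => i = v ∧ IsVertex e v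
  | SR.R, i => Matches e v i

/-- The edge `v →_{XY} v'` of the conflict graph of `e`. -/
def CGEdge (e : List (Act P M)) (X Y : SR) (v v' : ℕ) : Prop :=
  ∃ i j, XAt e v X i ∧ XAt e v' Y j ∧ i < j ∧
    ∃ a a' : Act P M, e[i]? = some a ∧ e[j]? = some a' ∧ a.proc = a'.proc

def CGStep (e : List (Act P M)) (v v' : ℕ) : Prop := ∃ X Y, CGEdge e X Y v v'

/-- Reachability `v →* v'` in the conflict graph. -/
def Reach (e : List (Act P M)) : ℕ → ℕ → Prop := Relation.ReflTransGen (CGStep e)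

/-- `U` is a strongly connected component of the conflict graph of `e`. -/
def IsSCC (e : List (Act P M)) (U : Finset ℕ) : Prop :=
  (∀ v ∈ U, IsVertex e v) ∧ ∀ v ∈ U, ∀ v' ∈ U, Reach e v v' ∧ Reach e v' v

/-- Extended edges `v ⊑_{XY} v'` of the extended conflict graph. -/
inductive ExtEdge (e : List (Act P M)) : SR → SR → ℕ → ℕ → Prop
  | base {X Y : SR} {v v' : ℕ} : CGEdge e X Y v v' → ExtEdge e X Y v v'
  | matched {v : ℕ} : MatchedSend e v → ExtEdge e SR.S SR.R v v
  | rr {v v' : ℕ} : CGEdge e SR.R SR.R v v' → ExtEdge e SR.S SR.S v v'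
  | mbox {v v' : ℕ} {q : P} : MatchedSend e v → UnmatchedSend e v' →
      ReceiverIs e v q → ReceiverIs e v' q → ExtEdge e SR.S SR.S v v'
  | trans {X Y Z : SR} {v v' v'' : ℕ} : ExtEdge e X Y v v'' → ExtEdge e Y Z v'' v' →
      ExtEdge e X Z v v'

/-- The process performing the `X`-action of the exchange `v`. -/
def XProcIs (e : List (Act P M)) (v : ℕ) : SR → P → Prop
  | SR.S, r => SenderIs e v r
  | SR.R, r => ∃ j, Matches e v j ∧ ∃ p m, e[j]? = some (Act.recv p r m)

/-- The set of processes involved in the exchange `v`. -/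
def vprocs (e : List (Act P M)) (v : ℕ) : Set P :=
  {r | SenderIs e v r ∨ (MatchedSend e v ∧ ReceiverIs e v r)}

end CG

/-! ## k-exchanges and k-synchronous MSCs -/

section KSync
variable {P M : Type} [DecidableEq P] [DecidableEq M]

/-- A block in `S^{≤k}·R^{≤k}`: at most `k` sends followed by at most `k` receives. -/
def IsBlock (k : ℕ) (b : List (Act P M)) : Prop :=
  ∃ ss rs : List (Act P M), b = ss ++ rs ∧ (∀ a ∈ ss, a.isSend) ∧ (∀ a ∈ rs, a.isRecv) ∧
    ss.length ≤ k ∧ rs.length ≤ k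

def blockStart (es : List (List (Act P M))) (b : ℕ) : ℕ :=
  ((es.take b).map List.length).sum

/-- Positions `i` and `j` of `es.flatten` lie in the same block of `es`. -/
def SameBlock (es : List (List (Act P M))) (i j : ℕ) : Prop :=
  ∃ b, b < es.length ∧ blockStart es b ≤ i ∧ i < blockStart es (b + 1) ∧
    blockStart es b ≤ j ∧ j < blockStart es (b + 1)

/-- An MSC is `k`-synchronous: it satisfies causal delivery and it has a linearisation
divisible into blocks of `S^{≤k}·R^{≤k}` in which every matched pair lies in one block. -/
def KSyncMSC (k : ℕ) (m : MSC P M) : Prop :=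
  CausalDelivery m ∧
  ∃ es : List (List (Act P M)), Linearisation es.flatten m ∧
    (∀ b ∈ es, IsBlock k b) ∧
    ∀ i j, Matches es.flatten i j → SameBlock es i j

/-- A sequence of actions is `k`-synchronizable if its MSC is `k`-synchronous. -/
def KSyncSeq (k : ℕ) (e : List (Act P M)) : Prop := KSyncMSC k (mscOf e)

/-- The peer-to-peer variant of `k`-synchrony. -/
def P2PKSyncMSC (k : ℕ) (m : MSC P M) : Prop :=
  P2PCausalDelivery m ∧
  ∃ es : List (List (Act P M)), Linearisation es.flatten m ∧
    (∀ b ∈ es, IsBlock k b) ∧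
    ∀ i j, Matches es.flatten i j → SameBlock es i j

def P2PKSyncSeq (k : ℕ) (e : List (Act P M)) : Prop := P2PKSyncMSC k (mscOf e)

end KSync

/-! ## Communicating systems (mailbox semantics) -/

/-- A system of communicating finite state machines: a transition relation and an
initial state for each process. -/
structure CSystem (P M St : Type) : Type where
  delta : P → St → Act P M → St → Prop
  init : P → St

section Mailbox
variable {P M St : Type} [DecidableEq P] [DecidableEq M]

/-- One step of the mailbox semantics on configurations (global state, one buffer per process). -/
inductive MStep (S : CSystem P M St) :
    ((P → St) × (P → List M)) → Act P M → ((P → St) × (P → List M)) → Prop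
  | send {l : P → St} {b : P → List M} {p q : P} {m : M} {l' : St} :
      S.delta p (l p) (Act.send p q m) l' →
      MStep S (l, b) (Act.send p q m)
        (Function.update l p l', Function.update b q (b q ++ [m]))
  | recv {l : P → St} {b : P → List M} {p q : P} {m : M} {l' : St} {rest : List M} :
      S.delta q (l q) (Act.recv p q m) l' → b q = m :: rest →
      MStep S (l, b) (Act.recv p q m)
        (Function.update l q l', Function.update b q rest)

/-- Execution of a sequence of actions between two configurations. -/
inductive ExecFrom (S : CSystem P M St) :
    ((P → St) × (P → List M)) → List (Act P M) → ((P → St) × (P → List M)) → Prop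
  | nil {c} : ExecFrom S c [] c
  | cons {c a c' e c''} : MStep S c a c' → ExecFrom S c' e c'' → ExecFrom S c (a :: e) c''

def initConf (S : CSystem P M St) : (P → St) × (P → List M) := (S.init, fun _ => [])

/-- `asEx(S)`: `e` is an (asynchronous) execution of `S`. -/
def asEx (S : CSystem P M St) (e : List (Act P M)) : Prop :=
  ∃ c, ExecFrom S (initConf S) e c

/-- `S` is `k`-synchronizable: every execution of `S` is `k`-synchronizable. -/
def KSynchronizable (k : ℕ) (S : CSystem P M St) : Prop :=
  ∀ e, asEx S e → KSyncSeq k e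

end Mailbox

/-! ## The instrumented system -/

abbrev IProc (P : Type) : Type := Option P
abbrev IMsg (P M : Type) : Type := Sum M (P × M)
abbrev ISt (P M St : Type) : Type := Sum St (Sum (P × M) Bool)
abbrev IAct (P M : Type) : Type := Act (IProc P) (IMsg P M)

def liftAct {P M : Type} : Act P M → IAct P M
  | Act.send p q m => Act.send (some p) (some q) (Sum.inl m)
  | Act.recv p q m => Act.recv (some p) (some q) (Sum.inl m)

/-- Transitions of the instrumented system `S'`: the original transitions, deviations
of sends/receives through the fresh process `π` (= `none`), and the behaviour of `π`. -/
inductive IDelta {P M St : Type} (S : CSystem P M St) :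
    IProc P → ISt P M St → IAct P M → ISt P M St → Prop
  | origSend {p q : P} {m : M} {s s' : St} :
      S.delta p s (Act.send p q m) s' →
      IDelta S (some p) (Sum.inl s) (Act.send (some p) (some q) (Sum.inl m)) (Sum.inl s')
  | origRecv {p q : P} {m : M} {s s' : St} :
      S.delta q s (Act.recv p q m) s' →
      IDelta S (some q) (Sum.inl s) (Act.recv (some p) (some q) (Sum.inl m)) (Sum.inl s')
  | devSend {p q : P} {m : M} {s s' : St} :
      S.delta p s (Act.send p q m) s' →
      IDelta S (some p) (Sum.inl s) (Act.send (some p) none (Sum.inr (q, m))) (Sum.inl s')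
  | devRecv {p q : P} {m : M} {s s' : St} :
      S.delta q s (Act.recv p q m) s' →
      IDelta S (some q) (Sum.inl s) (Act.recv none (some q) (Sum.inl m)) (Sum.inl s')
  | piRecv {p q : P} {m : M} :
      IDelta S none (Sum.inr (Sum.inr false)) (Act.recv (some p) none (Sum.inr (q, m)))
        (Sum.inr (Sum.inl (q, m)))
  | piSend {q : P} {m : M} :
      IDelta S none (Sum.inr (Sum.inl (q, m))) (Act.send none (some q) (Sum.inl m))
        (Sum.inr (Sum.inr true))

/-- The instrumented system `S'`. -/
def instrumented {P M St : Type} (S : CSystem P M St) :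
    CSystem (IProc P) (IMsg P M) (ISt P M St) where
  delta := IDelta S
  init := fun p => match p with
    | some p => Sum.inl (S.init p)
    | none => Sum.inr (Sum.inr false)

section Deviate
variable {P M St : Type} [DecidableEq P] [DecidableEq M]

/-- `e'` is obtained from `ec = e₁·send(p,q,m)·e₂·rec(p,q,m)` (the final receive being
matched by the exhibited send) by deviating that message exchange through `π`. -/
def Deviate (e' : List (IAct P M)) (ec : List (Act P M)) : Prop :=
  ∃ (e₁ e₂ : List (Act P M)) (p q : P) (m : M),
    ec = e₁ ++ [Act.send p q m] ++ e₂ ++ [Act.recv p q m] ∧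
    Matches ec e₁.length (ec.length - 1) ∧
    e' = e₁.map liftAct ++
      [Act.send (some p) none (Sum.inr (q, m)), Act.recv (some p) none (Sum.inr (q, m))] ++
      e₂.map liftAct ++
      [Act.send none (some q) (Sum.inl m), Act.recv none (some q) (Sum.inl m)]

/-- A (k-synchronizable) execution `e'` of `S'` is feasible if it is the deviation of an
execution of `S`. -/
def Feasible (S : CSystem P M St) (e' : List (IAct P M)) : Prop :=
  ∃ ec, asEx S ec ∧ Deviate e' ec

/-- A feasible execution `e' = deviate(e·r)` is bad if `e·r` is not `k`-synchronizable. -/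
def BadExec (k : ℕ) (S : CSystem P M St) (e' : List (IAct P M)) : Prop :=
  ∃ ec, asEx S ec ∧ Deviate e' ec ∧ ¬ KSyncSeq k ec

end Deviate

/-! ## Conflict graphs with summary nodes and the k-exchange transition relation -/

section Summary
variable {P M : Type} [DecidableEq P] [DecidableEq M]

/-- Select by `X ∈ {S,R}` the corresponding component of a pair of sets of processes. -/
def selC {P : Type} : SR → Set P × Set P → Set P
  | SR.S, c => c.1
  | SR.R, c => c.2

/-- Edges of the conflict graph `CG(e,B,Cπ)` with summary nodes `λ_p` and `ψ`.
(For the graph `CG(e,B)` without `ψ` take `Cπ = (∅,∅)`, which makes `ψ` isolated.) -/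
inductive SCGEdge (e : List (Act P M)) (B : P → Set P × Set P) (Cpi : Set P × Set P) :
    SR → SR → GNode P → GNode P → Prop
  | base {X Y : SR} {v v' : ℕ} :
      CGEdge e X Y v v' → SCGEdge e B Cpi X Y (GNode.ex v) (GNode.ex v')
  | sum1 {p : P} {X : SR} {v : ℕ} {r : P} :
      XProcIs e v X r → r ∈ (B p).1 → SCGEdge e B Cpi SR.S X (GNode.sum p) (GNode.ex v)
  | sum2 {p : P} {X : SR} {v : ℕ} {r : P} :
      XProcIs e v X r → r ∈ (B p).2 → MatchedSend e v →
      SCGEdge e B Cpi SR.S SR.S (GNode.sum p) (GNode.ex v)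
  | sum3 {p : P} {v : ℕ} {q : P} :
      ReceiverIs e v q → q ∈ (B p).2 → UnmatchedSend e v →
      SCGEdge e B Cpi SR.S SR.S (GNode.sum p) (GNode.ex v)
  | sum4 {p : P} {v : ℕ} :
      ReceiverIs e v p → MatchedSend e v →
      SCGEdge e B Cpi SR.S SR.S (GNode.ex v) (GNode.sum p)
  | sum5 {q p : P} :
      p ∈ (B q).2 → SCGEdge e B Cpi SR.S SR.S (GNode.sum q) (GNode.sum p)
  | psi1 {X : SR} {v : ℕ} {r : P} :
      XProcIs e v X r → r ∈ Cpi.1 → SCGEdge e B Cpi SR.S X GNode.psi (GNode.ex v)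
  | psi2 {X : SR} {v : ℕ} {r : P} :
      XProcIs e v X r → r ∈ Cpi.2 → MatchedSend e v →
      SCGEdge e B Cpi SR.S SR.S GNode.psi (GNode.ex v)
  | psi3 {v : ℕ} {q : P} :
      ReceiverIs e v q → q ∈ Cpi.2 → UnmatchedSend e v →
      SCGEdge e B Cpi SR.S SR.S GNode.psi (GNode.ex v)
  | psi4 {p : P} :
      p ∈ Cpi.2 → SCGEdge e B Cpi SR.S SR.S GNode.psi (GNode.sum p)

/-- Extended edges of the conflict graph with summary nodes. -/
inductive SExtEdge (e : List (Act P M)) (B : P → Set P × Set P) (Cpi : Set P × Set P) :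
    SR → SR → GNode P → GNode P → Prop
  | base {X Y : SR} {n n' : GNode P} :
      SCGEdge e B Cpi X Y n n' → SExtEdge e B Cpi X Y n n'
  | matched {v : ℕ} :
      MatchedSend e v → SExtEdge e B Cpi SR.S SR.R (GNode.ex v) (GNode.ex v)
  | rr {n n' : GNode P} :
      SCGEdge e B Cpi SR.R SR.R n n' → SExtEdge e B Cpi SR.S SR.S n n'
  | mbox {v v' : ℕ} {q : P} :
      MatchedSend e v → UnmatchedSend e v' → ReceiverIs e v q → ReceiverIs e v' q →
      SExtEdge e B Cpi SR.S SR.S (GNode.ex v) (GNode.ex v')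
  | trans {X Y Z : SR} {n n' n'' : GNode P} :
      SExtEdge e B Cpi X Y n n'' → SExtEdge e B Cpi Y Z n'' n' → SExtEdge e B Cpi X Z n n'

/-- The nodes `Unm_p`: the summary node `λ_p` together with the unmatched exchanges of `e`
with receiver `p`. -/
def UnmNode (e : List (Act P M)) (p : P) : GNode P → Prop
  | GNode.ex v => UnmatchedSend e v ∧ ReceiverIs e v p
  | GNode.sum q => q = p
  | GNode.psi => False

/-- The updated component `C'_{X,p}` of `B` after the k-exchange `e`. -/
def nextC (e : List (Act P M)) (B : P → Set P × Set P) (X : SR) (p : P) : Set P :=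
  selC X (B p)
  ∪ {s | X = SR.S ∧ ∃ v, UnmatchedSend e v ∧ ReceiverIs e v p ∧ SenderIs e v s}
  ∪ {r | ∃ n v', UnmNode e p n ∧
      SExtEdge e B ((∅, ∅) : Set P × Set P) SR.S SR.S n (GNode.ex v') ∧ XProcIs e v' X r}
  ∪ {r | ∃ q n, ((∃ v, n = GNode.ex v ∧ ReceiverIs e v p) ∨ n = GNode.sum p) ∧
      SExtEdge e B ((∅, ∅) : Set P × Set P) SR.S SR.S n (GNode.sum q) ∧ r ∈ selC X (B q)}

/-- The updated component `C^π_X'` after the k-exchange `e`, where `piP` is the process `π`. -/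
def nextCpi (piP : P) (e : List (Act P M)) (B : P → Set P × Set P) (Cpi : Set P × Set P)
    (X : SR) : Set P :=
  selC X Cpi
  ∪ {s | X = SR.S ∧ ∃ v, ReceiverIs e v piP ∧ SenderIs e v s}
  ∪ {r | ∃ n v', ((∃ v, n = GNode.ex v ∧ ReceiverIs e v piP) ∨ n = GNode.psi) ∧
      SExtEdge e B Cpi SR.S SR.S n (GNode.ex v') ∧ XProcIs e v' X r}
  ∪ {r | ∃ q n, ((∃ v, n = GNode.ex v ∧ ReceiverIs e v piP) ∨ n = GNode.psi) ∧
      SExtEdge e B Cpi SR.S SR.S n (GNode.sum q) ∧ r ∈ selC X (B q)}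

end Summary

section KExchange
variable {P M St : Type} [DecidableEq P] [DecidableEq M]

/-- The transition relation `(l⃗,B) ⇝^e_k (l⃗',B')` on abstract configurations. -/
def KExch (S : CSystem P M St) (k : ℕ) (e : List (Act P M))
    (c c' : (P → St) × (P → Set P × Set P)) : Prop :=
  (∃ ss rs : List (Act P M), e = ss ++ rs ∧ (∀ a ∈ ss, a.isSend) ∧ (∀ a ∈ rs, a.isRecv) ∧
    rs.length ≤ ss.length ∧ ss.length ≤ k) ∧
  (∃ buf, ExecFrom S (c.1, fun _ => []) e (c'.1, buf)) ∧
  (∀ p X, selC X (c'.2 p) = nextC e c.2 X p) ∧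
  ∀ p, p ∉ selC SR.R (c'.2 p)

/-- Iterated `⇝^{e_1}_k ⋯ ⇝^{e_n}_k`. -/
inductive KChain (S : CSystem P M St) (k : ℕ) :
    ((P → St) × (P → Set P × Set P)) → List (List (Act P M)) →
    ((P → St) × (P → Set P × Set P)) → Prop
  | nil {c} : KChain S k c [] c
  | cons {c e c' es c''} :
      KExch S k e c c' → KChain S k c' es c'' → KChain S k c (e :: es) c''

end KExchange

/-! ## The transition relation recognising feasible executions -/

/-- Abstract configurations `(l⃗, B, C⃗^π, dest)` for the instrumented system. -/
structure PiAConf (P M St : Type) : Type where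
  gs : IProc P → ISt P M St
  B : IProc P → Set (IProc P) × Set (IProc P)
  Cpi : Set (IProc P) × Set (IProc P)
  dest : Option P

section PiTrans
variable {P M St : Type} [DecidableEq P] [DecidableEq M]

/-- The transition relation `(l⃗,B,C^π_S,C^π_R,dest) ⇝^e_k (l⃗',B',C^π_S',C^π_R',dest')`. -/
def PiTrans (S : CSystem P M St) (k : ℕ) (e : List (IAct P M))
    (c c' : PiAConf P M St) : Prop :=
  KExch (instrumented S) k e (c.gs, c.B) (c'.gs, c'.B) ∧
  (∀ v, ¬ SenderIs e v (none : IProc P)) ∧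
  (∀ v v', ReceiverIs e v (none : IProc P) → ReceiverIs e v' (none : IProc P) →
    v = v' ∧ c.dest = none) ∧
  ((∃ (d : ℕ) (p q : P) (m : M),
      e[d]? = some (Act.send (some p) none (Sum.inr (q, m))) ∧ c'.dest = some q) ∨
   ((¬ ∃ (d : ℕ) (p q : P) (m : M),
      e[d]? = some (Act.send (some p) none (Sum.inr (q, m)))) ∧ c'.dest = c.dest)) ∧
  (c.dest ≠ none → c'.dest = c.dest) ∧
  (∀ X, selC X c'.Cpi = nextCpi (none : IProc P) e c.B c.Cpi X) ∧
  ∀ q : P, c'.dest = some q → (some q : IProc P) ∉ c'.Cpi.2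

inductive PiChain (S : CSystem P M St) (k : ℕ) :
    PiAConf P M St → List (List (IAct P M)) → PiAConf P M St → Prop
  | nil {c} : PiChain S k c [] c
  | cons {c e c' es c''} :
      PiTrans S k e c c' → PiChain S k c' es c'' → PiChain S k c (e :: es) c''

/-- The initial abstract configuration `(l⃗_0, B_0, (∅,∅), ⊥)`. -/
def initPi (S : CSystem P M St) : PiAConf P M St :=
  ⟨(instrumented S).init, fun _ => (∅, ∅), (∅, ∅), none⟩

end PiTrans

/-! ## The transition relation recognising bad executions -/

/-- Abstract configurations `(P, Q, cnt, sawRS, lastIsRec)`. -/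
structure BVConf (P : Type) : Type where
  Ps : Set P
  Qs : Set P
  cnt : ℕ
  sawRS : Bool
  lir : P → Bool

section BV
variable {P M : Type} [DecidableEq P] [DecidableEq M]

/-- `succ_e(Ps)`: vertices reachable from a vertex involving a process of `Ps`. -/
def succSet (e : List (Act P M)) (Ps : Set P) : Set ℕ :=
  {v | IsVertex e v ∧ ∃ u, IsVertex e u ∧ (∃ r ∈ vprocs e u, r ∈ Ps) ∧ Reach e u v}

/-- `pred_e(Qs)`: vertices co-reachable from a vertex involving a process of `Qs`. -/
def predSet (e : List (Act P M)) (Qs : Set P) : Set ℕ :=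
  {v | IsVertex e v ∧ ∃ u, IsVertex e u ∧ (∃ r ∈ vprocs e u, r ∈ Qs) ∧ Reach e v u}

/-- The transition relation of Fig. 9, `piP` being the process `π`. -/
def BTrans (piP : P) (k : ℕ) (e : List (Act P M)) (c c' : BVConf P) : Prop :=
  c'.Ps = {r | ∃ v ∈ succSet e c.Ps, r ∈ vprocs e v} ∧
  c.Qs = {r | ∃ v ∈ predSet e c'.Qs, r ∈ vprocs e v} ∧
  c'.cnt = min (k + 2) (c.cnt + (succSet e c.Ps ∩ predSet e c'.Qs).ncard) ∧
  (∀ q : P, c'.lir q = true ↔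
    ((∃ v ∈ succSet e c.Ps ∩ predSet e c'.Qs, MatchedSend e v ∧ ReceiverIs e v q) ∨
     (c.lir q = true ∧ ¬ ∃ v, IsVertex e v ∧ SenderIs e v q))) ∧
  (c'.sawRS = true ↔
    (c.sawRS = true ∨ ∃ v ∈ succSet e c.Ps ∩ predSet e c'.Qs, ∃ p : P, p ≠ piP ∧
      SenderIs e v p ∧ c.lir p = true ∧ p ∈ c.Ps ∧ p ∈ c.Qs))

inductive BChain (piP : P) (k : ℕ) :
    BVConf P → List (List (Act P M)) → BVConf P → Prop
  | nil {c} : BChain piP k c [] c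
  | cons {c e c' es c''} :
      BTrans piP k e c c' → BChain piP k c' es c'' → BChain piP k c (e :: es) c''

end BV

/-! ## Peer-to-peer systems -/

section P2P
variable {P M St : Type} [DecidableEq P] [DecidableEq M]

/-- One step of the peer-to-peer semantics (one buffer per ordered pair of processes). -/
inductive P2PStep (S : CSystem P M St) :
    ((P → St) × (P → P → List M)) → Act P M → ((P → St) × (P → P → List M)) → Prop
  | send {l : P → St} {b : P → P → List M} {p q : P} {m : M} {l' : St} :
      S.delta p (l p) (Act.send p q m) l' →
      P2PStep S (l, b) (Act.send p q m)
        (Function.update l p l',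
          fun p' q' => if p' = p ∧ q' = q then b p q ++ [m] else b p' q')
  | recv {l : P → St} {b : P → P → List M} {p q : P} {m : M} {l' : St} {rest : List M} :
      S.delta q (l q) (Act.recv p q m) l' → b p q = m :: rest →
      P2PStep S (l, b) (Act.recv p q m)
        (Function.update l q l',
          fun p' q' => if p' = p ∧ q' = q then rest else b p' q')

inductive P2PExecFrom (S : CSystem P M St) :
    ((P → St) × (P → P → List M)) → List (Act P M) → ((P → St) × (P → P → List M)) → Prop
  | nil {c} : P2PExecFrom S c [] c
  | cons {c a c' e c''} :
      P2PStep S c a c' → P2PExecFrom S c' e c'' → P2PExecFrom S c (a :: e) c''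

def p2pInitConf (S : CSystem P M St) : (P → St) × (P → P → List M) :=
  (S.init, fun _ _ => [])

/-- `e` is a peer-to-peer execution of `S`. -/
def p2pAsEx (S : CSystem P M St) (e : List (Act P M)) : Prop :=
  ∃ c, P2PExecFrom S (p2pInitConf S) e c

/-- `S` is `k`-synchronizable as a peer-to-peer system. -/
def P2PKSynchronizable (k : ℕ) (S : CSystem P M St) : Prop :=
  ∀ e, p2pAsEx S e → P2PKSyncSeq k e

/-- Feasibility for peer-to-peer systems. -/
def P2PFeasible (S : CSystem P M St) (e' : List (IAct P M)) : Prop :=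
  ∃ ec, p2pAsEx S ec ∧ Deviate e' ec

/-- Badness for peer-to-peer systems. -/
def P2PBadExec (k : ℕ) (S : CSystem P M St) (e' : List (IAct P M)) : Prop :=
  ∃ ec, p2pAsEx S ec ∧ Deviate e' ec ∧ ¬ P2PKSyncSeq k ec

/-- The staged update `B_1, …, B_{m+1}` of the forbidden-senders map along `e`. -/
def stageB (e : List (Act P M)) (B : P → Set P) : ℕ → P → Set P
  | 0 => B
  | (i + 1) => fun q =>
      stageB e B i q ∪ {p | ∃ m, e[i]? = some (Act.send p q m) ∧ ¬ MatchedSend e i}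

/-- The peer-to-peer transition relation `(l⃗,B) ⇝^e_k (l⃗',B')`. -/
def P2PKExch (S : CSystem P M St) (k : ℕ) (e : List (Act P M))
    (c c' : (P → St) × (P → Set P)) : Prop :=
  (∃ ss rs : List (Act P M), e = ss ++ rs ∧ (∀ a ∈ ss, a.isSend) ∧ (∀ a ∈ rs, a.isRecv) ∧
    rs.length ≤ ss.length ∧ ss.length ≤ k) ∧
  (∃ buf, P2PExecFrom S (c.1, fun _ _ => []) e (c'.1, buf)) ∧
  c'.2 = stageB e c.2 e.length ∧
  ∀ i p q m, e[i]? = some (Act.send p q m) → MatchedSend e i → p ∉ stageB e c.2 i q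

inductive P2PKChain (S : CSystem P M St) (k : ℕ) :
    ((P → St) × (P → Set P)) → List (List (Act P M)) → ((P → St) × (P → Set P)) → Prop
  | nil {c} : P2PKChain S k c [] c
  | cons {c e c' es c''} :
      P2PKExch S k e c c' → P2PKChain S k c' es c'' → P2PKChain S k c (e :: es) c''

end P2P

/-- Abstract configurations `(l⃗, B, exp, dest)` for the peer-to-peer instrumented system. -/
structure P2PPiConf (P M St : Type) : Type where
  gs : IProc P → ISt P M St
  B : IProc P → Set (IProc P)
  exp : Option P
  dest : Option P

section P2PPi
variable {P M St : Type} [DecidableEq P] [DecidableEq M]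

/-- The peer-to-peer transition relation `(l⃗,B,exp,dest) ⇝^e_k (l⃗',B',exp',dest')`. -/
def P2PPiTrans (S : CSystem P M St) (k : ℕ) (e : List (IAct P M))
    (c c' : P2PPiConf P M St) : Prop :=
  P2PKExch (instrumented S) k e (c.gs, c.B) (c'.gs, c'.B) ∧
  (∀ v, ¬ SenderIs e v (none : IProc P)) ∧
  (∀ v v', ReceiverIs e v (none : IProc P) → ReceiverIs e v' (none : IProc P) →
    v = v' ∧ c.dest = none) ∧
  ((∃ (d : ℕ) (p q : P) (m : M),
      e[d]? = some (Act.send (some p) none (Sum.inr (q, m))) ∧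
      c'.exp = some p ∧ c'.dest = some q ∧
      (c.dest = none → ∀ v, d < v → MatchedSend e v →
        ¬ (SenderIs e v (some p) ∧ ReceiverIs e v (some q)))) ∨
   ((¬ ∃ (d : ℕ) (p q : P) (m : M),
      e[d]? = some (Act.send (some p) none (Sum.inr (q, m)))) ∧
      c'.exp = c.exp ∧ c'.dest = c.dest)) ∧
  (c.dest ≠ none → c'.dest = c.dest ∧ c'.exp = c.exp) ∧
  (∀ p q : P, c'.exp = some p → c'.dest = some q → c.dest ≠ none →
    ∀ v, MatchedSend e v → ¬ (SenderIs e v (some p) ∧ ReceiverIs e v (some q)))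

inductive P2PPiChain (S : CSystem P M St) (k : ℕ) :
    P2PPiConf P M St → List (List (IAct P M)) → P2PPiConf P M St → Prop
  | nil {c} : P2PPiChain S k c [] c
  | cons {c e c' es c''} :
      P2PPiTrans S k e c c' → P2PPiChain S k c' es c'' → P2PPiChain S k c (e :: es) c''

/-- The initial abstract configuration `(l⃗_0, B_0, ⊥, ⊥)`. -/
def initP2PPi (S : CSystem P M St) : P2PPiConf P M St :=
  ⟨(instrumented S).init, fun _ => ∅, none, none⟩

end P2PPi

section BlockPositions
variable {α : Type*}

/-- Every position of `Ls.flatten` lies at some offset of some block. -/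
theorem exists_block_offset (Ls : List (List α)) (i : ℕ) (hi : i < Ls.flatten.length) :
    ∃ b o l, Ls[b]? = some l ∧ o < l.length ∧
      i = ((Ls.take b).map List.length).sum + o ∧ Ls.flatten[i]? = l[o]? := by
  induction Ls generalizing i with
  | nil => simp at hi
  | cons l Ls ih =>
    by_cases h : i < l.length
    · exact ⟨0, i, l, by simp, h, by simp, by simp [List.getElem?_append_left h]⟩
    · push Not at h
      have hi' : i - l.length < Ls.flatten.length := by
        rw [List.flatten_cons, List.length_append] at hi
        omega
      obtain ⟨b, o, l', hb, ho, hio, hget⟩ := ih _ hi'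
      refine ⟨b + 1, o, l', by simpa using hb, ho, ?_, ?_⟩
      · simp only [List.take_succ_cons, List.map_cons, List.sum_cons]
        omega
      · rw [List.flatten_cons, List.getElem?_append_right h, hget]

theorem sum_length_take_succ {Ls : List (List α)} {b : ℕ} {l : List α} (h : Ls[b]? = some l) :
    ((Ls.take (b + 1)).map List.length).sum = ((Ls.take b).map List.length).sum + l.length := by
  simp [List.take_add_one, h]

theorem sum_length_take_mono (Ls : List (List α)) {a b : ℕ} (h : a ≤ b) :
    ((Ls.take a).map List.length).sum ≤ ((Ls.take b).map List.length).sum :=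
  (((List.take_sublist_take_left h).map _)).sum_le_sum (by simp)

end BlockPositions

section Counting
variable {α : Type*} [DecidableEq α]

theorem count_take_eq_card (l : List α) (a : α) (m : ℕ) :
    (l.take m).count a = ((Finset.range m).filter (fun y => l[y]? = some a)).card := by
  induction m with
  | zero => simp
  | succ m ih =>
    rw [List.take_add_one, List.count_append, ih, Finset.range_add_one, Finset.filter_insert]
    by_cases h : l[m]? = some a
    · simp [h]
    · rw [if_neg h, Nat.add_eq_left]
      cases hm : l[m]? with
      | none => simp
      | some c =>
        have hc : c ≠ a := fun hc => h (by rw [hm, hc])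
        simp [hc]

theorem eq_of_count_take_eq {l : List α} {a : α} {i j : ℕ} (hi : l[i]? = some a)
    (hj : l[j]? = some a) (h : (l.take (i + 1)).count a = (l.take (j + 1)).count a) : i = j := by
  wlog hij : i < j generalizing i j
  · by_contra hne
    exact hne (this hj hi h.symm (by omega)).symm
  exfalso
  have h1 : (l.take (j + 1)).count a = (l.take j).count a + 1 := by
    simp [List.take_add_one, hj]
  have h2 : (l.take (i + 1)).count a ≤ (l.take j).count a :=
    (List.take_sublist_take_left hij).count_le a
  omega

end Counting

/-- A reflexive-transitive closure on `{0, …, n - 1}` admits a ranking that is monotone along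
steps and whose fibres are the classes of mutually reachable elements. -/
theorem exists_rank (r : ℕ → ℕ → Prop) (n : ℕ) :
    ∃ (rank : ℕ → ℕ) (N : ℕ), (∀ v < n, rank v < N) ∧
      (∀ v < n, ∀ w < n, r v w → rank v ≤ rank w) ∧
      ∀ v < n, ∀ w < n, rank v = rank w → Relation.ReflTransGen r v w := by
  classical
  let anc : ℕ → Finset ℕ := fun v =>
    (Finset.range n).filter (fun u => Relation.ReflTransGen r u v)
  let low : ℕ → ℕ := fun v =>
    sInf {u | Relation.ReflTransGen r u v ∧ Relation.ReflTransGen r v u}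
  have low_le : ∀ v, low v ≤ v := fun v => Nat.sInf_le ⟨.refl, .refl⟩
  have low_mem : ∀ v, Relation.ReflTransGen r (low v) v ∧ Relation.ReflTransGen r v (low v) :=
    fun v => Nat.sInf_mem (s := {u | Relation.ReflTransGen r u v ∧ Relation.ReflTransGen r v u})
      ⟨v, .refl, .refl⟩
  let rank : ℕ → ℕ := fun v => low v + n * (anc v).card
  refine ⟨rank, (Finset.range n).sup rank + 1, ?_, ?_, ?_⟩
  · intro v hv
    exact Nat.lt_succ_of_le (Finset.le_sup (f := rank) (Finset.mem_range.2 hv))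
  · intro v hv w hw hvw
    have hvw : Relation.ReflTransGen r v w := .single hvw
    have hsub : anc v ⊆ anc w := by
      intro u hu
      rw [Finset.mem_filter] at hu ⊢
      exact ⟨hu.1, hu.2.trans hvw⟩
    by_cases hwv : Relation.ReflTransGen r w v
    · have hanc : anc v = anc w := by
        refine hsub.antisymm fun u hu => ?_
        rw [Finset.mem_filter] at hu ⊢
        exact ⟨hu.1, hu.2.trans hwv⟩
      have hlow : low v = low w := by
        refine congrArg sInf (Set.ext fun u => ?_)
        exact ⟨fun h => ⟨h.1.trans hvw, hwv.trans h.2⟩, fun h => ⟨h.1.trans hwv, hvw.trans h.2⟩⟩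
      simp only [rank, hanc, hlow, le_refl]
    · have hlt : (anc v).card < (anc w).card := by
        refine Finset.card_lt_card (hsub.ssubset_of_mem_notMem (a := w) ?_ ?_)
        · exact Finset.mem_filter.2 ⟨Finset.mem_range.2 hw, .refl⟩
        · exact fun h => hwv (Finset.mem_filter.1 h).2
      have h1 := low_le v
      have h2 : n * ((anc v).card + 1) ≤ n * (anc w).card := Nat.mul_le_mul_left n hlt
      simp only [rank]
      rw [Nat.mul_add] at h2
      omega
  · intro v hv w hw h
    have hlow : low v = low w := by
      have h1 := congrArg (· % n) h
      simpa [rank, Nat.mod_eq_of_lt ((low_le v).trans_lt hv),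
        Nat.mod_eq_of_lt ((low_le w).trans_lt hw)] using h1
    exact (low_mem v).2.trans (hlow ▸ (low_mem w).1)

section Matching
variable {P M : Type} {e : List (Act P M)}

theorem IsVertex.lt_length {v : ℕ} (h : IsVertex e v) : v < e.length := by
  obtain ⟨p, q, m, h⟩ := h
  exact (List.getElem?_eq_some_iff.1 h).1

variable [DecidableEq P] [DecidableEq M]

theorem Matches.isVertex {i j : ℕ} (h : Matches e i j) : IsVertex e i := by
  obtain ⟨-, -, p, q, m, hi, -⟩ := h
  exact ⟨p, q, m, hi⟩

theorem Matches.not_isVertex {i j : ℕ} (h : Matches e i j) : ¬ IsVertex e j := by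
  obtain ⟨-, -, p, q, m, -, hj, -⟩ := h
  rintro ⟨p', q', m', h'⟩
  simp [hj] at h'

theorem Matches.send_unique {i i' j : ℕ} (h : Matches e i j) (h' : Matches e i' j) :
    i = i' := by
  obtain ⟨-, -, p, q, m, hi, hj, hc⟩ := h
  obtain ⟨-, -, p', q', m', hi', hj', hc'⟩ := h'
  obtain ⟨rfl, rfl, rfl⟩ : p = p' ∧ q = q' ∧ m = m' := by simpa [hj] using hj'
  exact eq_of_count_take_eq hi hi' (hc.trans hc'.symm)

theorem Matches.recv_unique {i j j' : ℕ} (h : Matches e i j) (h' : Matches e i j') :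
    j = j' := by
  obtain ⟨-, -, p, q, m, hi, hj, hc⟩ := h
  obtain ⟨-, -, p', q', m', hi', hj', hc'⟩ := h'
  obtain ⟨rfl, rfl, rfl⟩ : p = p' ∧ q = q' ∧ m = m' := by simpa [hi] using hi'
  exact eq_of_count_take_eq hj hj' (hc.symm.trans hc')

theorem XAt.lt_length {v i : ℕ} {X : SR} (h : XAt e v X i) : i < e.length := by
  cases X with
  | S => exact h.1 ▸ h.2.lt_length
  | R => exact h.2.1

theorem XAt.isVertex {v i : ℕ} {X : SR} (h : XAt e v X i) : IsVertex e v := by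
  cases X with
  | S => exact h.2
  | R => exact Matches.isVertex h

/-- Every position of a well-formed sequence belongs to a message exchange. -/
theorem WFSeq.exists_owner (h : WFSeq e) (x : ℕ) (hx : x < e.length) :
    ∃ v, (IsVertex e x ∧ v = x) ∨ Matches e v x := by
  cases hxe : e[x] with
  | send p q m => exact ⟨x, .inl ⟨⟨p, q, m, by simp [hx, hxe]⟩, rfl⟩⟩
  | recv p q m =>
    obtain ⟨i, hi⟩ := h x p q m (by simp [hx, hxe])
    exact ⟨i, .inr hi⟩

end Matching

section Isomorphisms
variable {P M : Type}

theorem IsMSCIso.symm {m₁ m₂ : MSC P M} {f : Fin m₁.n ≃ Fin m₂.n} (h : IsMSCIso m₁ m₂ f) :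
    IsMSCIso m₂ m₁ f.symm := by
  refine ⟨fun i => ?_, fun i j => ?_, fun i j => ?_⟩
  · rw [← h.1, f.apply_symm_apply]
  · rw [h.2.1, f.apply_symm_apply, f.apply_symm_apply]
  · rw [h.2.2, f.apply_symm_apply, f.apply_symm_apply]

theorem IsMSCIso.trans {m₁ m₂ m₃ : MSC P M} {f : Fin m₁.n ≃ Fin m₂.n} {g : Fin m₂.n ≃ Fin m₃.n}
    (hf : IsMSCIso m₁ m₂ f) (hg : IsMSCIso m₂ m₃ g) : IsMSCIso m₁ m₃ (f.trans g) := by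
  refine ⟨fun i => ?_, fun i j => ?_, fun i j => ?_⟩
  · rw [f.trans_apply, hg.1, hf.1]
  · rw [f.trans_apply, f.trans_apply, hf.2.1, hg.2.1]
  · rw [f.trans_apply, f.trans_apply, hf.2.2, hg.2.2]

variable [DecidableEq P] [DecidableEq M]

theorem Linearisation.exists_iso {e e' : List (Act P M)} {msc : MSC P M}
    (h : Linearisation e msc) (h' : Linearisation e' msc) :
    ∃ f : Fin e.length ≃ Fin e'.length, IsMSCIso (mscOf e) (mscOf e') f := by
  obtain ⟨-, f, hf⟩ := h
  obtain ⟨-, g, hg⟩ := h'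
  exact ⟨f.trans g.symm, hf.trans hg.symm⟩

end Isomorphisms

section BlocksToGraph
variable {P M : Type}

theorem IsBlock.exists_split {k : ℕ} {l : List (Act P M)} (h : IsBlock k l) :
    ∃ s ≤ k, (∀ o p q m, l[o]? = some (Act.send p q m) → o < s) ∧
      ∀ o p q m, l[o]? = some (Act.recv p q m) → s ≤ o := by
  obtain ⟨ss, rs, rfl, hs, hr, hk, -⟩ := h
  refine ⟨ss.length, hk, fun o p q m ho => ?_, fun o p q m ho => ?_⟩
  · by_contra! hlt
    rw [List.getElem?_append_right hlt] at ho
    exact hr _ (List.mem_of_getElem? ho)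
  · by_contra! hlt
    rw [List.getElem?_append_left hlt] at ho
    exact hs _ (List.mem_of_getElem? ho)

variable [DecidableEq P] [DecidableEq M]

theorem scc_card_le_and_no_RS_cycle {k : ℕ} {e : List (Act P M)} {es : List (List (Act P M))}
    {f : Fin e.length ≃ Fin es.flatten.length} (hf : IsMSCIso (mscOf e) (mscOf es.flatten) f)
    (hblock : ∀ b ∈ es, IsBlock k b)
    (hmatch : ∀ i j, Matches es.flatten i j → SameBlock es i j) :
    (∀ U : Finset ℕ, IsSCC e U → U.card ≤ k) ∧
      ¬ ∃ v v', CGEdge e SR.R SR.S v v' ∧ Reach e v' v := by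
  obtain ⟨hlab, hpo, hsrc⟩ := hf
  choose b o l hb ho hpos hget using
    fun i : Fin es.flatten.length => exists_block_offset es i i.2
  have hstart : ∀ i, blockStart es (b i) ≤ i ∧ i < blockStart es (b i + 1) := by
    intro i
    have h1 := hpos i
    have h2 := ho i
    rw [blockStart, blockStart, sum_length_take_succ (hb i)]
    omega
  have hbmono : ∀ (i : ℕ) (c c' : ℕ), blockStart es c ≤ i → i < blockStart es (c' + 1) →
      c ≤ c' := by
    intro i c c' h1 h2
    by_contra! h
    have := sum_length_take_mono es (show c' + 1 ≤ c from h)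
    simp only [blockStart] at h1 h2
    omega
  have hble : ∀ i j, i ≤ j → b i ≤ b j := fun i j hij =>
    hbmono i _ _ (hstart i).1 (lt_of_le_of_lt hij (hstart j).2)
  have hbeq : ∀ i j : Fin es.flatten.length, Matches es.flatten i j → b i = b j := by
    intro i j hij
    obtain ⟨c, -, h1, h2, h3, h4⟩ := hmatch _ _ hij
    have := hbmono i _ _ h1 (hstart i).2
    have := hbmono i _ _ (hstart i).1 h2
    have := hbmono j _ _ h3 (hstart j).2
    have := hbmono j _ _ (hstart j).1 h4
    omega
  have hlabel : ∀ i : Fin e.length, (l (f i))[o (f i)]? = some e[i] := by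
    intro i
    rw [← hget]
    rw [List.getElem?_eq_getElem (f i).2]
    exact congrArg some (hlab i)
  let blk : ℕ → ℕ := fun v => if h : v < e.length then b (f ⟨v, h⟩) else 0
  have hblk : ∀ i : Fin e.length, blk i = b (f i) := fun i => dif_pos i.2
  have hblkX : ∀ {X : SR} {v i : ℕ} (h : XAt e v X i), blk v = b (f ⟨i, h.lt_length⟩) := by
    intro X v i h
    cases X with
    | S =>
      obtain ⟨rfl, -⟩ := id h
      exact hblk ⟨i, h.lt_length⟩
    | R =>
      rw [hblk ⟨v, h.isVertex.lt_length⟩]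
      exact hbeq _ _ ((hsrc ⟨v, h.isVertex.lt_length⟩ ⟨i, h.lt_length⟩).1 h)
  have hlt : ∀ {i j : Fin e.length} {a a' : Act P M}, i < j → e[(i : ℕ)]? = some a →
      e[(j : ℕ)]? = some a' → a.proc = a'.proc → f i < f j := by
    intro i j a a' hij hi hj haa
    refine ((hpo i j).1 ⟨hij, ?_⟩).1
    simp only [Fin.is_lt, getElem?_pos, Option.some.injEq] at hi hj
    simpa [hi, hj] using haa
  have hstep : ∀ {v v' : ℕ}, CGStep e v v' → blk v ≤ blk v' := by
    rintro v v' ⟨X, Y, i, j, hi, hj, hij, a, a', ha, ha', haa⟩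
    rw [hblkX hi, hblkX hj]
    exact hble _ _ (hlt (i := ⟨i, hi.lt_length⟩) (j := ⟨j, hj.lt_length⟩) hij ha ha' haa).le
  have hreach : ∀ {v v' : ℕ}, Reach e v v' → blk v ≤ blk v' := by
    intro v v' h
    induction h with
    | refl => exact le_rfl
    | tail _ h ih => exact ih.trans (hstep h)
  constructor
  · rintro U ⟨hU, hUr⟩
    rcases U.eq_empty_or_nonempty with rfl | ⟨u, hu⟩
    · simp
    obtain ⟨s, hsk, hs, -⟩ :=
      (hblock _ (List.mem_of_getElem? (hb (f ⟨u, (hU u hu).lt_length⟩)))).exists_split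
    refine (Finset.card_le_card_of_injOn (t := Finset.range s)
      (fun v => if h : v < e.length then o (f ⟨v, h⟩) else 0) ?_ ?_).trans (by simpa using hsk)
    · intro v hv
      have hvl := (hU v hv).lt_length
      obtain ⟨p, q, m, hsend⟩ := hU v hv
      have hbb : b (f ⟨v, hvl⟩) = b (f ⟨u, (hU u hu).lt_length⟩) := by
        rw [← hblk, ← hblk]
        exact le_antisymm (hreach (hUr v hv u hu).1) (hreach (hUr v hv u hu).2)
      have hll : l (f ⟨v, hvl⟩) = l (f ⟨u, (hU u hu).lt_length⟩) := by
        have h1 := hb (f ⟨v, hvl⟩)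
        rw [hbb, hb] at h1
        exact (Option.some.inj h1).symm
      simp only [hvl, dif_pos, Finset.coe_range, Set.mem_Iio]
      refine hs _ p q m ?_
      rw [← hll, hlabel, ← hsend]
      simp [hvl]
    · intro v hv w hw h
      have hvl := (hU v hv).lt_length
      have hwl := (hU w hw).lt_length
      simp only [hvl, hwl, dif_pos] at h
      have hbb : b (f ⟨v, hvl⟩) = b (f ⟨w, hwl⟩) := by
        rw [← hblk, ← hblk]
        exact le_antisymm (hreach (hUr v hv w hw).1) (hreach (hUr v hv w hw).2)
      have hfe : f ⟨v, hvl⟩ = f ⟨w, hwl⟩ := by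
        apply Fin.ext
        rw [hpos, hpos (f ⟨w, hwl⟩), hbb, h]
      simpa using f.injective hfe
  · rintro ⟨v, v', h, hr⟩
    have hle := hreach hr
    obtain ⟨i, j, hi, hj, hij, a, a', ha, ha', haa⟩ := h
    have hflt := hlt (i := ⟨i, hi.lt_length⟩) (j := ⟨j, hj.lt_length⟩) hij ha ha' haa
    have hbb : b (f ⟨i, hi.lt_length⟩) = b (f ⟨j, hj.lt_length⟩) := by
      refine le_antisymm (hble _ _ hflt.le) ?_
      rwa [← hblkX hi, ← hblkX hj]
    have hll : l (f ⟨i, hi.lt_length⟩) = l (f ⟨j, hj.lt_length⟩) := by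
      have h1 := hb (f ⟨i, hi.lt_length⟩)
      rw [hbb, hb] at h1
      exact (Option.some.inj h1).symm
    obtain ⟨s, -, hs, hr⟩ :=
      (hblock _ (List.mem_of_getElem? (hb (f ⟨j, hj.lt_length⟩)))).exists_split
    obtain ⟨hjv, p, q, m, hsend⟩ := id hj
    rw [← hjv] at hsend
    obtain ⟨-, hil, p', q', m', -, hrecv, -⟩ := id hi
    have h1 := hs (o (f ⟨j, (List.getElem?_eq_some_iff.1 hsend).1⟩)) p q m (by
      rw [hlabel, ← hsend]; simp)
    have h2 := hr (o (f ⟨i, hil⟩)) p' q' m' (by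
      rw [← hll, hlabel, ← hrecv]; simp [hil])
    have h3 := hpos (f ⟨i, hil⟩)
    have h4 := hpos (f ⟨j, (List.getElem?_eq_some_iff.1 hsend).1⟩)
    rw [← hbb] at h4
    have h5 : (f ⟨i, hil⟩ : ℕ) < f ⟨j, (List.getElem?_eq_some_iff.1 hsend).1⟩ := hflt
    omega

end BlocksToGraph

section Reordering
variable {P M : Type} [DecidableEq P] [DecidableEq M]

/-- Permuting a well-formed sequence without changing the order on each process, nor moving a
receive before its send, yields a linearisation of the same MSC. -/
theorem WFSeq.reorder {e e' : List (Act P M)} (hwf : WFSeq e)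
    (f : Fin e'.length ≃ Fin e.length) (hlab : ∀ i, e'[i] = e[f i])
    (hpo : ∀ i j, e'[i].proc = e'[j].proc → (i < j ↔ f i < f j))
    (hm : ∀ i j, Matches e (f i) (f j) → i < j) :
    WFSeq e' ∧ IsMSCIso (mscOf e') (mscOf e) f := by
  have hlab? : ∀ i : Fin e'.length, e'[(i : ℕ)]? = e[(f i : ℕ)]? := by
    intro i
    rw [List.getElem?_eq_getElem i.2, List.getElem?_eq_getElem (f i).2]
    exact congrArg some (hlab i)
  have hcount : ∀ (i : Fin e'.length) (a : Act P M), e'[(i : ℕ)]? = some a →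
      (e'.take (i + 1)).count a = (e.take (f i + 1)).count a := by
    intro i a hi
    rw [count_take_eq_card, count_take_eq_card]
    have hget : ∀ y : Fin e'.length, e'[(y : ℕ)]? = some a → e'[y] = a := by
      intro y hy
      simpa using hy
    have hle : ∀ y : Fin e'.length, e'[(y : ℕ)]? = some a → (y ≤ i ↔ f y ≤ f i) := by
      intro y hy
      rw [← not_lt, ← not_lt, hpo i y (by rw [hget i hi, hget y hy])]
    refine Finset.card_bij
      (fun y hy => (f ⟨y, (List.getElem?_eq_some_iff.1 (Finset.mem_filter.1 hy).2).1⟩ : ℕ))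
      ?_ ?_ ?_
    · intro y hy
      obtain ⟨hyi, hya⟩ := Finset.mem_filter.1 hy
      have hyl := (List.getElem?_eq_some_iff.1 hya).1
      refine Finset.mem_filter.2 ⟨?_, (hlab? ⟨y, hyl⟩).symm.trans hya⟩
      rw [Finset.mem_range, Nat.lt_succ_iff] at hyi ⊢
      exact (hle ⟨y, hyl⟩ hya).1 hyi
    · intro y hy z hz h
      simpa using f.injective (Fin.ext h)
    · intro z hz
      obtain ⟨hzi, hza⟩ := Finset.mem_filter.1 hz
      have hzl := (List.getElem?_eq_some_iff.1 hza).1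
      have hya : e'[(f.symm ⟨z, hzl⟩ : ℕ)]? = some a := by
        rw [hlab?, f.apply_symm_apply]
        exact hza
      refine ⟨f.symm ⟨z, hzl⟩, Finset.mem_filter.2 ⟨?_, hya⟩, by simp⟩
      rw [Finset.mem_range, Nat.lt_succ_iff] at hzi ⊢
      refine (hle _ hya).2 ?_
      rw [f.apply_symm_apply]
      exact hzi
  have hmatch : ∀ i j : Fin e'.length, Matches e' i j ↔ Matches e (f i) (f j) := by
    intro i j
    constructor
    · rintro ⟨-, -, p, q, m, hi, hj, hc⟩
      rw [hcount i _ hi, hcount j _ hj] at hc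
      rw [hlab?] at hi hj
      obtain ⟨x, hx⟩ := hwf _ _ _ _ hj
      obtain ⟨-, -, p', q', m', hx1, hx2, hxc⟩ := id hx
      obtain ⟨rfl, rfl, rfl⟩ : p = p' ∧ q = q' ∧ m = m' := by
        simpa using hj.symm.trans hx2
      rwa [eq_of_count_take_eq hi hx1 (hc.trans hxc.symm)]
    · intro h
      have hij := hm i j h
      obtain ⟨-, -, p, q, m, hi, hj, hc⟩ := h
      rw [← hlab?] at hi hj
      rw [← hcount i _ hi, ← hcount j _ hj] at hc
      exact ⟨hij, j.2, p, q, m, hi, hj, hc⟩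
  refine ⟨fun j p q m hj => ?_, fun i => (hlab i).symm, fun i j => ?_, hmatch⟩
  · have hjl := (List.getElem?_eq_some_iff.1 hj).1
    obtain ⟨x, hx⟩ := hwf (f ⟨j, hjl⟩) p q m (by rw [← hlab?]; exact hj)
    refine ⟨f.symm ⟨x, hx.isVertex.lt_length⟩, (hmatch _ ⟨j, hjl⟩).2 ?_⟩
    rwa [f.apply_symm_apply]
  · have h : ∀ i j : Fin e'.length, e'[i].proc = e'[j].proc ↔ e[f i].proc = e[f j].proc := by
      intro i j
      rw [hlab, hlab]
    exact ⟨fun ⟨h1, h2⟩ => ⟨(hpo i j h2).1 h1, (h i j).1 h2⟩,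
      fun ⟨h1, h2⟩ => ⟨(hpo i j ((h i j).2 h2)).2 h1, (h i j).2 h2⟩⟩

end Reordering

section GraphToBlocks
variable {P M : Type} [DecidableEq P] [DecidableEq M]

theorem exists_blocks {k : ℕ} {e : List (Act P M)} (hwf : WFSeq e)
    (hscc : ∀ U : Finset ℕ, IsSCC e U → U.card ≤ k)
    (hRS : ¬ ∃ v v', CGEdge e SR.R SR.S v v' ∧ Reach e v' v) :
    ∃ es : List (List (Act P M)), (WFSeq es.flatten ∧
        ∃ f : Fin es.flatten.length ≃ Fin e.length, IsMSCIso (mscOf es.flatten) (mscOf e) f) ∧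
      (∀ b ∈ es, IsBlock k b) ∧ ∀ i j, Matches es.flatten i j → SameBlock es i j := by
  classical
  obtain ⟨rank, N, hN, hrank, hrank_eq⟩ := exists_rank (CGStep e) e.length
  choose own hown using fun x : Fin e.length => hwf.exists_owner x x.2
  have hownV : ∀ x, IsVertex e (own x) := by
    intro x
    rcases hown x with ⟨h, h'⟩ | h
    · rwa [h']
    · exact h.isVertex
  have hownS : ∀ x : Fin e.length, IsVertex e x → own x = x := by
    intro x hx
    rcases hown x with ⟨h, h'⟩ | h
    · exact h'
    · exact absurd hx h.not_isVertex
  have hownR : ∀ x : Fin e.length, ¬ IsVertex e x → Matches e (own x) x := by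
    intro x hx
    rcases hown x with ⟨h, h'⟩ | h
    · exact absurd h hx
    · exact h
  have hownX : ∀ x : Fin e.length, ∃ X, XAt e (own x) X x := by
    intro x
    by_cases hx : IsVertex e x
    · exact ⟨SR.S, (hownS x hx).symm, hownV x⟩
    · exact ⟨SR.R, hownR x hx⟩
  have hownM : ∀ x y : Fin e.length, Matches e x y → own x = own y := by
    intro x y h
    rw [hownS x h.isVertex]
    exact h.send_unique (hownR y h.not_isVertex)
  let rk : Fin e.length → ℕ := fun x => rank (own x)
  have hedge : ∀ {x y : Fin e.length} {X Y : SR}, XAt e (own x) X x → XAt e (own y) Y y →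
      x < y → e[x].proc = e[y].proc → CGEdge e X Y (own x) (own y) := by
    intro x y X Y hX hY hxy hp
    exact ⟨x, y, hX, hY, hxy, e[x], e[y], by simp, by simp, hp⟩
  have hrk : ∀ {x y : Fin e.length}, x < y → e[x].proc = e[y].proc → rk x ≤ rk y := by
    intro x y hxy hp
    obtain ⟨X, hX⟩ := hownX x
    obtain ⟨Y, hY⟩ := hownX y
    exact hrank _ (hownV x).lt_length _ (hownV y).lt_length ⟨X, Y, hedge hX hY hxy hp⟩
  let sends : ℕ → List (Fin e.length) := fun r =>
    (List.finRange e.length).filter (fun x => IsVertex e x ∧ rk x = r)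
  let recvs : ℕ → List (Fin e.length) := fun r =>
    (List.finRange e.length).filter (fun x => ¬ IsVertex e x ∧ rk x = r)
  have mem_sends : ∀ r x, x ∈ sends r ↔ IsVertex e x ∧ rk x = r := by simp [sends]
  have mem_recvs : ∀ r x, x ∈ recvs r ↔ ¬ IsVertex e x ∧ rk x = r := by simp [recvs]
  have hlen : ∀ (l : List (Fin e.length)) (r : ℕ), l.Nodup → (∀ x ∈ l, rk x = r) →
      (∀ x ∈ l, ∀ y ∈ l, own x = own y → x = y) → l.length ≤ k := by
    intro l r hl hr hinj
    rw [← List.toFinset_card_of_nodup hl, ← Finset.card_image_of_injOn (f := own)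
      (fun x hx y hy h => hinj x (by simpa using hx) y (by simpa using hy) h)]
    refine hscc _ ⟨?_, ?_⟩
    · simp only [Finset.mem_image]
      rintro _ ⟨x, -, rfl⟩
      exact hownV x
    · simp only [Finset.mem_image, List.mem_toFinset]
      rintro _ ⟨x, hx, rfl⟩ _ ⟨y, hy, rfl⟩
      have h : rank (own x) = rank (own y) := (hr x hx).trans (hr y hy).symm
      exact ⟨hrank_eq _ (hownV x).lt_length _ (hownV y).lt_length h,
        hrank_eq _ (hownV y).lt_length _ (hownV x).lt_length h.symm⟩
  let Ls : List (List (Fin e.length)) := (List.range N).map (fun r => sends r ++ recvs r)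
  have hLs : ∀ b l, Ls[b]? = some l → b < N ∧ l = sends b ++ recvs b := by
    intro b l h
    obtain ⟨hb, h⟩ := List.getElem?_eq_some_iff.1 h
    simp only [Ls, List.length_map, List.length_range] at hb
    exact ⟨hb, by simpa [Ls] using h.symm⟩
  have mem_block : ∀ r x, x ∈ sends r ++ recvs r ↔ rk x = r := by
    intro r x
    rw [List.mem_append, mem_sends, mem_recvs]
    tauto
  have hpair : Ls.flatten.Pairwise (fun x y : Fin e.length => x ≠ y ∧
      (e[x].proc = e[y].proc → x < y) ∧ ¬ Matches e y x) := by
    rw [← List.flatMap_def, List.pairwise_flatMap]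
    constructor
    · intro r _
      rw [List.pairwise_append]
      refine ⟨?_, ?_, ?_⟩
      · refine (List.Pairwise.filter _ (List.pairwise_lt_finRange _)).imp_of_mem ?_
        intro x y hx _ hxy
        exact ⟨hxy.ne, fun _ => hxy, fun h => h.not_isVertex ((mem_sends r x).1 hx).1⟩
      · refine (List.Pairwise.filter _ (List.pairwise_lt_finRange _)).imp_of_mem ?_
        intro x y _ hy hxy
        exact ⟨hxy.ne, fun _ => hxy, fun h => ((mem_recvs r y).1 hy).1 h.isVertex⟩
      · intro x hx y hy
        obtain ⟨hx, hxr⟩ := (mem_sends r x).1 hx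
        obtain ⟨hy, hyr⟩ := (mem_recvs r y).1 hy
        have hne : x ≠ y := by
          rintro rfl
          exact hy hx
        refine ⟨hne, fun hp => ?_, fun h => hy h.isVertex⟩
        by_contra hlt
        have hyx : y < x := lt_of_le_of_ne (not_lt.1 hlt) hne.symm
        exact hRS ⟨own y, own x,
          hedge (X := SR.R) (Y := SR.S) (hownR y hy) ⟨(hownS x hx).symm, hownV x⟩ hyx hp.symm,
          hrank_eq _ (hownV x).lt_length _ (hownV y).lt_length (hxr.trans hyr.symm)⟩
    · refine List.pairwise_lt_range.imp ?_
      intro r r' hrr x hx y hy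
      rw [mem_block] at hx hy
      have hne : x ≠ y := by
        rintro rfl
        omega
      refine ⟨hne, fun hp => ?_, fun h => ?_⟩
      · by_contra hlt
        have := hrk (lt_of_le_of_ne (not_lt.1 hlt) hne.symm) hp.symm
        omega
      · have : rk y = rk x := congrArg rank (hownM y x h)
        omega
  have hnodup : Ls.flatten.Nodup := hpair.imp fun h => h.1
  have hmem : ∀ x, x ∈ Ls.flatten := by
    intro x
    rw [← List.flatMap_def, List.mem_flatMap]
    exact ⟨rk x, List.mem_range.2 (hN _ (hownV x).lt_length), (mem_block _ _).2 rfl⟩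
  let es : List (List (Act P M)) := Ls.map (List.map e.get)
  have hes : es.flatten = Ls.flatten.map e.get := List.map_flatten.symm
  have hlenes : es.flatten.length = Ls.flatten.length := by rw [hes, List.length_map]
  let f : Fin es.flatten.length ≃ Fin e.length :=
    (finCongr hlenes).trans (hnodup.getEquivOfForallMemList _ hmem)
  have hf : ∀ i : Fin es.flatten.length, Ls.flatten[(i : ℕ)]? = some (f i) := by
    intro i
    rw [List.getElem?_eq_getElem (hlenes ▸ i.2)]
    rfl
  have hrel : ∀ i j, i < j → f i ≠ f j ∧ (e[f i].proc = e[f j].proc → f i < f j) ∧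
      ¬ Matches e (f j) (f i) := fun i j hij =>
    List.pairwise_iff_getElem.1 hpair i j (hlenes ▸ i.2) (hlenes ▸ j.2) hij
  have hlab : ∀ i, es.flatten[i] = e[f i] := by
    intro i
    have h : es.flatten[(i : ℕ)]? = some e[f i] := by
      refine (congrArg (fun l => l[(i : ℕ)]?) hes).trans ?_
      rw [List.getElem?_map, hf]
      rfl
    rw [List.getElem?_eq_getElem i.2] at h
    exact Option.some.inj h
  have hiso := hwf.reorder f hlab (by
    intro i j hp
    rw [hlab, hlab] at hp
    refine ⟨fun h => (hrel i j h).2.1 hp, fun h => ?_⟩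
    rcases lt_trichotomy i j with hij | rfl | hij
    · exact hij
    · exact absurd h (lt_irrefl _)
    · exact absurd h ((hrel j i hij).2.1 hp.symm).asymm) (by
    intro i j h
    rcases lt_trichotomy i j with hij | rfl | hij
    · exact hij
    · exact absurd h.isVertex h.not_isVertex
    · exact absurd h (hrel j i hij).2.2)
  refine ⟨es, ⟨hiso.1, f, hiso.2⟩, ?_, ?_⟩
  · simp only [es, Ls, List.map_map, List.mem_map, List.mem_range, Function.comp_apply]
    rintro _ ⟨r, -, rfl⟩
    refine ⟨(sends r).map e.get, (recvs r).map e.get, List.map_append, ?_, ?_, ?_, ?_⟩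
    · simp only [List.mem_map]
      rintro _ ⟨x, hx, rfl⟩
      obtain ⟨⟨p, q, m, h⟩, -⟩ := (mem_sends r x).1 hx
      have h : e.get x = Act.send p q m := by simpa using h
      rw [h]
      trivial
    · simp only [List.mem_map]
      rintro _ ⟨x, hx, rfl⟩
      obtain ⟨-, -, p, q, m, -, h, -⟩ := hownR x ((mem_recvs r x).1 hx).1
      have h : e.get x = Act.recv p q m := by simpa using h
      rw [h]
      trivial
    · rw [List.length_map]
      refine hlen _ r ((List.nodup_finRange _).filter _) (fun x hx => ((mem_sends r x).1 hx).2) ?_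
      intro x hx y hy h
      rw [hownS x ((mem_sends r x).1 hx).1, hownS y ((mem_sends r y).1 hy).1] at h
      exact Fin.ext h
    · rw [List.length_map]
      refine hlen _ r ((List.nodup_finRange _).filter _) (fun x hx => ((mem_recvs r x).1 hx).2) ?_
      intro x hx y hy h
      have hmx := hownR x ((mem_recvs r x).1 hx).1
      rw [h] at hmx
      exact Fin.ext (hmx.recv_unique (hownR y ((mem_recvs r y).1 hy).1))
  · have hstart : ∀ c, blockStart es c = ((Ls.take c).map List.length).sum := by
      intro c
      simp only [blockStart, es, ← List.map_take, List.map_map]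
      congr 2
      funext l
      simp
    have hpos : ∀ i, rk (f i) < es.length ∧ blockStart es (rk (f i)) ≤ i ∧
        i < blockStart es (rk (f i) + 1) := by
      intro i
      obtain ⟨b, o, l, hb, ho, hio, hget⟩ := exists_block_offset Ls i (hlenes ▸ i.2)
      have hl := hLs b l hb
      rw [hf] at hget
      have hb' : rk (f i) = b := by
        rw [← mem_block, ← hl.2]
        exact List.mem_of_getElem? hget.symm
      rw [hb', hstart, hstart, sum_length_take_succ hb]
      refine ⟨by simpa [es, Ls] using hl.1, ?_, ?_⟩ <;> omega
    intro i j h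
    have hil := h.isVertex.lt_length
    have hjl := h.2.1
    have hfm : Matches e (f ⟨i, hil⟩) (f ⟨j, hjl⟩) := (hiso.2.2.2 ⟨i, hil⟩ ⟨j, hjl⟩).1 h
    have hrr : rk (f ⟨i, hil⟩) = rk (f ⟨j, hjl⟩) := congrArg rank (hownM _ _ hfm)
    have h1 := hpos ⟨i, hil⟩
    have h2 := hpos ⟨j, hjl⟩
    rw [← hrr] at h2
    exact ⟨_, h1.1, h1.2.1, h1.2.2, h2.2.1, h2.2.2⟩

end GraphToBlocks

/-! ## Statement 2: graph-theoretic characterisation of k-synchronous MSCs. -/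

theorem ksynchronous_iff_scc_and_no_RS_cycle
    {P M : Type} [Fintype P] [DecidableEq P] [Fintype M] [DecidableEq M]
    (k : ℕ) (hk : 1 ≤ k) (msc : MSC P M) (hwf : msc.WF) (hcd : CausalDelivery msc)
    (e : List (Act P M)) (hlin : Linearisation e msc) :
    KSyncMSC k msc ↔
      ((∀ U : Finset ℕ, IsSCC e U → U.card ≤ k) ∧
        ¬ ∃ v v', CGEdge e SR.R SR.S v v' ∧ Reach e v' v) := by
  constructor
  · rintro ⟨-, es, hes, hblock, hmatch⟩
    obtain ⟨f, hf⟩ := hlin.exists_iso hes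
    exact scc_card_le_and_no_RS_cycle hf hblock hmatch
  · rintro ⟨hscc, hRS⟩
    obtain ⟨hwfe, g, hg⟩ := hlin
    obtain ⟨es, ⟨hwfes, f, hf⟩, hblock, hmatch⟩ := exists_blocks hwfe hscc hRS
    exact ⟨hcd, es, ⟨hwfes, f.trans g, hf.trans hg⟩, hblock, hmatch⟩
end

section
/- If a mailbox system S is not k-synchronizable, then S admits a borderline violation: there is an execution e'·r ∈ asEx(S) whose last action r is a receive action, such that e'·r is not k-synchronizable but e' is k-synchronizable. -/
set_option autoImplicit false

section AppendSend
variable {P M : Type}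

theorem ExecFrom.of_append {St : Type} [DecidableEq P] {S : CSystem P M St}
    {e₁ e₂ : List (Act P M)} {c c' : (P → St) × (P → List M)}
    (h : ExecFrom S c (e₁ ++ e₂) c') : ∃ c'', ExecFrom S c e₁ c'' := by
  induction e₁ generalizing c with
  | nil => exact ⟨c, .nil⟩
  | cons a e₁ ih =>
    cases h with
    | cons hstep hrest =>
      obtain ⟨c'', hc⟩ := ih hrest
      exact ⟨c'', .cons hstep hc⟩

theorem Act.isRecv_of_not_isSend {a : Act P M} (h : ¬ a.isSend) : a.isRecv := by
  cases a with
  | send p q m => exact h trivial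
  | recv p q m => trivial

theorem SameBlock.append {es : List (List (Act P M))} {i j : ℕ} (h : SameBlock es i j)
    (es' : List (List (Act P M))) : SameBlock (es ++ es') i j := by
  obtain ⟨b, hb, h⟩ := h
  refine ⟨b, by rw [List.length_append]; omega, ?_⟩
  have h₁ : blockStart (es ++ es') b = blockStart es b := by
    rw [blockStart, blockStart, List.take_append_of_le_length (by omega)]
  have h₂ : blockStart (es ++ es') (b + 1) = blockStart es (b + 1) := by
    rw [blockStart, blockStart, List.take_append_of_le_length (by omega)]
  rwa [h₁, h₂]

variable [DecidableEq P] [DecidableEq M]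

theorem matches_append_send {e : List (Act P M)} {a : Act P M} (ha : a.isSend) {i j : ℕ} :
    Matches (e ++ [a]) i j ↔ Matches e i j := by
  have key : ∀ {i j : ℕ}, i < j → j < e.length →
      (e ++ [a])[i]? = e[i]? ∧ (e ++ [a])[j]? = e[j]? ∧
      (e ++ [a]).take (i + 1) = e.take (i + 1) ∧ (e ++ [a]).take (j + 1) = e.take (j + 1) := by
    intro i j hij hj
    exact ⟨List.getElem?_append_left (by omega), List.getElem?_append_left hj,
      List.take_append_of_le_length (by omega), List.take_append_of_le_length (by omega)⟩
  constructor
  · rintro ⟨hij, hj, p, q, m, h1, h2, h3⟩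
    have hj' : j < e.length := by
      by_contra hcon
      have hje : j = e.length := by
        rw [List.length_append, List.length_singleton] at hj
        omega
      subst hje
      rw [List.getElem?_concat_length] at h2
      cases h2
      exact ha
    obtain ⟨k1, k2, k3, k4⟩ := key hij hj'
    rw [k1] at h1
    rw [k2] at h2
    rw [k3, k4] at h3
    exact ⟨hij, hj', p, q, m, h1, h2, h3⟩
  · rintro ⟨hij, hj, p, q, m, h1, h2, h3⟩
    obtain ⟨k1, k2, k3, k4⟩ := key hij hj
    rw [← k1] at h1
    rw [← k2] at h2
    rw [← k3, ← k4] at h3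
    exact ⟨hij, by rw [List.length_append]; omega, p, q, m, h1, h2, h3⟩

theorem Matches.lt {e : List (Act P M)} {i j : ℕ} (h : Matches e i j) : i < j := h.1

theorem Matches.lt_length {e : List (Act P M)} {i j : ℕ} (h : Matches e i j) : j < e.length :=
  h.2.1

theorem WFSeq.append_send {e : List (Act P M)} (he : WFSeq e) {a : Act P M} (ha : a.isSend) :
    WFSeq (e ++ [a]) := by
  intro j p q m hj
  rcases lt_trichotomy j e.length with hlt | rfl | hgt
  · rw [List.getElem?_append_left hlt] at hj
    obtain ⟨i, hi⟩ := he j p q m hj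
    exact ⟨i, (matches_append_send ha).2 hi⟩
  · rw [List.getElem?_concat_length] at hj
    cases hj
    exact ha.elim
  · rw [List.getElem?_eq_none (by simp; omega)] at hj
    cases hj

/-- An event of `msc(e)` seen as an event of `msc(e·a)`. -/
def embEvent (e : List (Act P M)) (a : Act P M) (i : Fin (mscOf e).n) :
    Fin (mscOf (e ++ [a])).n :=
  ⟨i.val, lt_of_lt_of_le i.isLt (by simp [mscOf])⟩

/-- The last event of `msc(e·a)`. -/
def lastEvent (e : List (Act P M)) (a : Act P M) : Fin (mscOf (e ++ [a])).n :=
  ⟨e.length, by simp [mscOf]⟩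

theorem event_cases (e : List (Act P M)) (a : Act P M) (i : Fin (mscOf (e ++ [a])).n) :
    (∃ j, i = embEvent e a j) ∨ i = lastEvent e a := by
  have hi : i.val < (e ++ [a]).length := i.isLt
  rw [List.length_append, List.length_singleton] at hi
  rcases Nat.lt_succ_iff_lt_or_eq.1 hi with h | h
  · exact .inl ⟨⟨i.val, h⟩, rfl⟩
  · exact .inr (Fin.ext h)

theorem label_embEvent (e : List (Act P M)) (a : Act P M) (i : Fin (mscOf e).n) :
    (mscOf (e ++ [a])).label (embEvent e a i) = (mscOf e).label i :=
  List.getElem_append_left i.isLt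

theorem label_lastEvent (e : List (Act P M)) (a : Act P M) :
    (mscOf (e ++ [a])).label (lastEvent e a) = a := by
  simp [mscOf, lastEvent]

theorem po_iff {e : List (Act P M)} {i j : Fin (mscOf e).n} :
    (mscOf e).po i j ↔
      i.val < j.val ∧ ((mscOf e).label i).proc = ((mscOf e).label j).proc := Iff.rfl

theorem src_iff {e : List (Act P M)} {i j : Fin (mscOf e).n} :
    (mscOf e).src i j ↔ Matches e i.val j.val := Iff.rfl

theorem exists_equiv_append (e₁ e₂ : List (Act P M)) (a : Act P M)
    (f : Fin (mscOf e₁).n ≃ Fin (mscOf e₂).n) :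
    ∃ g : Fin (mscOf (e₁ ++ [a])).n ≃ Fin (mscOf (e₂ ++ [a])).n,
      (∀ i, g (embEvent e₁ a i) = embEvent e₂ a (f i)) ∧
      g (lastEvent e₁ a) = lastEvent e₂ a := by
  have h₁ : (mscOf (e₁ ++ [a])).n = (mscOf e₁).n + 1 := by simp [mscOf]
  have h₂ : (mscOf e₂).n + 1 = (mscOf (e₂ ++ [a])).n := by simp [mscOf]
  refine ⟨(finCongr h₁).trans ((finSumFinEquiv.symm.trans
    ((f.sumCongr (Equiv.refl (Fin 1))).trans finSumFinEquiv)).trans (finCongr h₂)), ?_, ?_⟩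
  · intro i
    have : finCongr h₁ (embEvent e₁ a i) = Fin.castAdd 1 i := rfl
    simp only [Equiv.trans_apply, this, finSumFinEquiv_symm_apply_castAdd]
    rfl
  · have : finCongr h₁ (lastEvent e₁ a) = Fin.natAdd (mscOf e₁).n (0 : Fin 1) := rfl
    simp only [Equiv.trans_apply, this, finSumFinEquiv_symm_apply_natAdd]
    rfl

theorem Linearisation.append_send {e e₀ : List (Act P M)} (h : Linearisation e (mscOf e₀))
    {a : Act P M} (ha : a.isSend) : Linearisation (e ++ [a]) (mscOf (e₀ ++ [a])) := by
  obtain ⟨hwf, f, hlab, hpo, hsrc⟩ := h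
  obtain ⟨g, hg, hglast⟩ := exists_equiv_append e e₀ a f
  have hlab' : ∀ i, (mscOf (e₀ ++ [a])).label (g i) = (mscOf (e ++ [a])).label i := by
    intro i
    rcases event_cases e a i with ⟨i, rfl⟩ | rfl
    · rw [hg, label_embEvent, label_embEvent, hlab]
    · rw [hglast, label_lastEvent, label_lastEvent]
  refine ⟨hwf.append_send ha, g, hlab', fun i j => ?_, fun i j => ?_⟩
  · rw [po_iff, po_iff, hlab', hlab']
    refine and_congr_left fun hproc => ?_
    rcases event_cases e a i with ⟨i, rfl⟩ | rfl <;> rcases event_cases e a j with ⟨j, rfl⟩ | rfl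
    · rw [label_embEvent, label_embEvent] at hproc
      have := hpo i j
      rw [po_iff, po_iff, hlab, hlab, and_iff_left hproc, and_iff_left hproc] at this
      rw [hg, hg]
      exact this
    · rw [hg, hglast]
      exact iff_of_true i.isLt (f i).isLt
    · rw [hg, hglast]
      exact iff_of_false (not_lt_of_gt j.isLt) (not_lt_of_gt (f j).isLt)
    · rw [hglast]
      exact iff_of_false (lt_irrefl _) (lt_irrefl _)
  · rw [src_iff, src_iff, matches_append_send ha, matches_append_send ha]
    rcases event_cases e a j with ⟨j, rfl⟩ | rfl
    · rcases event_cases e a i with ⟨i, rfl⟩ | rfl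
      · rw [hg, hg]
        exact hsrc i j
      · rw [hg, hglast]
        exact iff_of_false (fun h => not_lt_of_gt j.isLt h.lt)
          (fun h => not_lt_of_gt (f j).isLt h.lt)
    · rw [hglast]
      exact iff_of_false (fun h => lt_irrefl _ h.lt_length) (fun h => lt_irrefl _ h.lt_length)

theorem prec_lt {e : List (Act P M)} {i j : Fin (mscOf e).n} (h : (mscOf e).prec i j) :
    i.val < j.val := by
  induction h with
  | single h => exact h.elim (fun h => h.1) (fun h => h.1)
  | tail _ h ih => exact ih.trans (h.elim (fun h => h.1) (fun h => h.1))

theorem prec_embEvent {e : List (Act P M)} {a : Act P M} (ha : a.isSend)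
    {i j : Fin (mscOf e).n} :
    (mscOf (e ++ [a])).prec (embEvent e a i) (embEvent e a j) ↔ (mscOf e).prec i j := by
  have step : ∀ i j : Fin (mscOf e).n,
      ((mscOf (e ++ [a])).po (embEvent e a i) (embEvent e a j) ∨
        (mscOf (e ++ [a])).src (embEvent e a i) (embEvent e a j)) ↔
      ((mscOf e).po i j ∨ (mscOf e).src i j) := by
    intro i j
    rw [po_iff, po_iff, src_iff, src_iff, matches_append_send ha, label_embEvent, label_embEvent]
    rfl
  constructor
  · intro h
    generalize hx : embEvent e a j = x at h
    induction h generalizing j with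
    | single h =>
      subst hx
      exact .single ((step _ _).1 h)
    | tail _ h ih =>
      subst hx
      rename_i y _
      rcases event_cases e a y with ⟨y, rfl⟩ | rfl
      · exact .tail (ih rfl) ((step _ _).1 h)
      · exact absurd (prec_lt (.single h)) (not_lt_of_gt j.isLt)
  · intro h
    induction h with
    | single h => exact .single ((step _ _).2 h)
    | tail _ h ih => exact .tail ih ((step _ _).2 h)

theorem CausalDelivery.append_send {e₀ : List (Act P M)} (h : CausalDelivery (mscOf e₀))
    {a : Act P M} (ha : a.isSend) : CausalDelivery (mscOf (e₀ ++ [a])) := by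
  obtain ⟨e, hlin, hcd⟩ := h
  refine ⟨e ++ [a], hlin.append_send ha, fun i j p p' q v v' hij hi hj => ?_⟩
  rcases event_cases e a j with ⟨j, rfl⟩ | rfl
  · rcases event_cases e a i with ⟨i, rfl⟩ | rfl
    · rw [label_embEvent] at hi hj
      rcases hcd i j p p' q v v' ((prec_embEvent ha).1 hij) hi hj with h | ⟨i', j', h1, h2, h3⟩
      · exact .inl fun ⟨l, hl⟩ => h ⟨l, (matches_append_send ha).1 hl⟩
      · exact .inr ⟨embEvent e a i', embEvent e a j', (matches_append_send ha).2 h1,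
          (matches_append_send ha).2 h2, (prec_embEvent ha).2 h3⟩
    · exact absurd (prec_lt hij) (not_lt_of_gt j.isLt)
  · refine .inl fun ⟨l, hl⟩ => ?_
    have hl' := (matches_append_send ha).1 hl
    exact lt_asymm hl'.lt hl'.lt_length

/-- Sending one more message preserves `k`-synchronizability. -/
theorem KSyncSeq.append_send {k : ℕ} (hk : 1 ≤ k) {e : List (Act P M)} (h : KSyncSeq k e)
    {a : Act P M} (ha : a.isSend) : KSyncSeq k (e ++ [a]) := by
  obtain ⟨hcd, es, hlin, hblock, hsame⟩ := h
  have hflat : (es ++ [[a]]).flatten = es.flatten ++ [a] := by simp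
  refine ⟨hcd.append_send ha, es ++ [[a]], ?_, fun b hb => ?_, fun i j hij => ?_⟩
  · rw [hflat]
    exact hlin.append_send ha
  · rcases List.mem_append.1 hb with hb | hb
    · exact hblock b hb
    · rw [List.mem_singleton.1 hb]
      exact ⟨[a], [], by simp, by simpa using ha, by simp, by simpa using hk, by simp⟩
  · rw [hflat, matches_append_send ha] at hij
    exact (hsame i j hij).append _

theorem kSyncSeq_nil (k : ℕ) : KSyncSeq k ([] : List (Act P M)) := by
  have hlin : Linearisation ([] : List (Act P M)) (mscOf []) :=
    ⟨fun j p q m hj => by simp at hj, Equiv.refl _, fun _ => rfl, fun _ _ => Iff.rfl,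
      fun _ _ => Iff.rfl⟩
  exact ⟨⟨[], hlin, fun i => i.elim0⟩, [], hlin, by simp, fun i j h => absurd h.lt_length (by simp)⟩

end AppendSend

/-! ## Statement 5: a non k-synchronizable system admits a borderline violation. -/

theorem exists_borderline_violation
    {P M St : Type} [Fintype P] [DecidableEq P] [Fintype M] [DecidableEq M] [Fintype St]
    (k : ℕ) (hk : 1 ≤ k) (S : CSystem P M St) (h : ¬ KSynchronizable k S) :
    ∃ (e' : List (Act P M)) (r : Act P M), r.isRecv ∧ asEx S (e' ++ [r]) ∧
      ¬ KSyncSeq k (e' ++ [r]) ∧ KSyncSeq k e' := by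
  obtain ⟨e, hex, hns⟩ : ∃ e, asEx S e ∧ ¬ KSyncSeq k e := by
    simpa [KSynchronizable] using h
  induction e using List.reverseRecOn with
  | nil => exact absurd (kSyncSeq_nil k) hns
  | append_singleton e a ih =>
    by_cases hs : KSyncSeq k e
    · exact ⟨e, a, Act.isRecv_of_not_isSend fun ha => hns (hs.append_send hk ha), hex, hns, hs⟩
    · obtain ⟨c, hc⟩ := hex
      exact ih hc.of_append hs
end
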